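/- Let v : ℝ → ℝ be continuous and bounded with |v(x)| ≤ C(1+|x|)^{−3−ε} for some ε > 0, C > 0. Then for every k with Im k > 0 and a(k) ≠ 0, the limit lim_{n→∞} ∫_{−n}^{n} ( f₁(x,k) f₂(x,k) − a(k) ) dx exists and equals i ȧ(k), where ȧ denotes the derivative of a with respect to k. (Equivalently, the regularized trace of the difference of resolvents satisfies Tr(R_λ − R⁰_λ) = −(d/dλ) log a(√λ) with λ = k², which is Faddeev's formula for the characteristic determinant det(H − λI) = a(√λ).) -/

import Mathlib

open Real Set MeasureTheory Filter Complex

/-- `f` (with derivative `f'` and second derivative `f''`) is a twice continuously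
differentiable solution of the one-dimensional Schrödinger equation `-f'' + v·f = k²·f` on `ℝ`. -/
def IsSchrodingerSolution (v : ℝ → ℝ) (k : ℂ) (f f' f'' : ℝ → ℂ) : Prop :=
  (∀ x : ℝ, HasDerivAt f (f' x) x) ∧ (∀ x : ℝ, HasDerivAt f' (f'' x) x) ∧
    Continuous f'' ∧ (∀ x : ℝ, -(f'' x) + (v x : ℂ) * f x = k ^ 2 * f x)

/-- The Jost asymptotics at `+∞`: `e^{-ikx} f(x) → 1` and `e^{-ikx} f'(x) → ik` as `x → +∞`. -/
def IsJostAtPlusInfinity (k : ℂ) (f f' : ℝ → ℂ) : Prop :=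
  Tendsto (fun x : ℝ => Complex.exp (-Complex.I * k * x) * f x) atTop (nhds 1) ∧
    Tendsto (fun x : ℝ => Complex.exp (-Complex.I * k * x) * f' x) atTop (nhds (Complex.I * k))

/-- The Jost asymptotics at `-∞`: `e^{ikx} f(x) → 1` and `e^{ikx} f'(x) → -ik` as `x → -∞`. -/
def IsJostAtMinusInfinity (k : ℂ) (f f' : ℝ → ℂ) : Prop :=
  Tendsto (fun x : ℝ => Complex.exp (Complex.I * k * x) * f x) atBot (nhds 1) ∧
    Tendsto (fun x : ℝ => Complex.exp (Complex.I * k * x) * f' x) atBot (nhds (-Complex.I * k))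


lemma fad_incr {g g' : ℝ → ℂ} {h h' : ℝ → ℝ} {a b : ℝ} (hab : a ≤ b)
    (hg : ∀ x, a ≤ x → HasDerivAt g (g' x) x) (hh : ∀ x, a ≤ x → HasDerivAt h (h' x) x)
    (hle : ∀ x, a ≤ x → ‖g' x‖ ≤ h' x) : ‖g b - g a‖ ≤ h b - h a := by
  have := image_norm_le_of_norm_deriv_right_le_deriv_boundary' (f := fun x => g x - g a)
    (f' := g') (a := a) (b := b) (B := fun x => h x - h a) (B' := h')
    (fun x hx => ((hg x hx.1).sub_const _).continuousAt.continuousWithinAt)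
    (fun x hx => ((hg x hx.1).sub_const _).hasDerivWithinAt) (by simp)
    (fun x hx => ((hh x hx.1).sub_const _).continuousAt.continuousWithinAt)
    (fun x hx => ((hh x hx.1).sub_const _).hasDerivWithinAt)
    (fun x hx => hle x hx.1)
  exact this ⟨hab, le_rfl⟩

lemma fad_tail {g g' : ℝ → ℂ} {h h' : ℝ → ℝ}
    (hg : ∀ x, 0 ≤ x → HasDerivAt g (g' x) x) (hh : ∀ x, 0 ≤ x → HasDerivAt h (h' x) x)
    (hle : ∀ x, 0 ≤ x → ‖g' x‖ ≤ - h' x) (g0 : Tendsto g atTop (nhds 0))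
    (h0 : Tendsto h atTop (nhds 0)) (x : ℝ) (hx : 0 ≤ x) : ‖g x‖ ≤ h x := by
  have t1 : Tendsto (fun T => ‖g T - g x‖) atTop (nhds ‖0 - g x‖) := (g0.sub_const _).norm
  have t2 : Tendsto (fun T => (- h T) - (- h x)) atTop (nhds (-0 - (- h x))) :=
    h0.neg.sub_const _
  have := le_of_tendsto_of_tendsto t1 t2 (by
    filter_upwards [eventually_ge_atTop x] with T hT
    exact fad_incr (h := fun y => - h y) (h' := fun y => - h' y) hT (fun y hy => hg y (hx.trans hy))
      (fun y hy => (hh y (hx.trans hy)).neg) (fun y hy => hle y (hx.trans hy)))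
  simpa using this

lemma fad_norm_exp (c : ℂ) (x : ℝ) : ‖Complex.exp (Complex.I * c * x)‖ = Real.exp (-(c.im * x)) := by
  rw [Complex.norm_exp]; congr 1; simp [Complex.mul_re, Complex.mul_im]

lemma fad_norm_exp' (c : ℂ) (x : ℝ) : ‖Complex.exp (-Complex.I * c * x)‖ = Real.exp (c.im * x) := by
  rw [Complex.norm_exp]; congr 1; simp [Complex.mul_re, Complex.mul_im]

lemma fad_exp_deriv (c : ℂ) (x : ℝ) :
    HasDerivAt (fun x : ℝ => Complex.exp (c * x)) (c * Complex.exp (c * x)) x := by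
  have h : HasDerivAt (fun x : ℝ => c * (x : ℂ)) (c * 1) x :=
    (Complex.ofRealCLM.hasDerivAt (x := x)).const_mul c
  simpa [mul_comm] using h.cexp

lemma fad_phi_deriv (A : ℝ) (x : ℝ) (hx : 0 ≤ x) :
    HasDerivAt (fun x : ℝ => Real.exp (A / (1 + x) ^ 2))
      (-(2 * A / (1 + x) ^ 3 * Real.exp (A / (1 + x) ^ 2))) x := by
  have h1 : HasDerivAt (fun x : ℝ => 1 + x) 1 x := (hasDerivAt_id x).const_add 1
  have hne : (1 + x) ≠ 0 := by positivity
  have h2 := ((hasDerivAt_const x A).fun_div (h1.fun_pow 2) (pow_ne_zero 2 hne)).exp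
  convert h2 using 1
  simp
  field_simp

lemma fad_phi_tendsto (A : ℝ) :
    Tendsto (fun x : ℝ => Real.exp (A / (1 + x) ^ 2)) atTop (nhds 1) := by
  have : Tendsto (fun x : ℝ => A / (1 + x) ^ 2) atTop (nhds 0) :=
    Tendsto.div_atTop tendsto_const_nhds
      ((tendsto_pow_atTop (by norm_num)).comp (tendsto_atTop_add_const_left _ _ tendsto_id))
  simpa [Function.comp_def] using (Real.continuous_exp.tendsto 0).comp this

/-- one contraction step -/
lemma fad_step (v : ℝ → ℝ) (C η : ℝ) (hη : 0 < η) (hC : 0 ≤ C)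
    (hb : ∀ x, 0 ≤ x → |v x| ≤ C / (1 + x) ^ 3) (κ : ℂ) (hκ : η ≤ κ.im) (f f' : ℝ → ℂ)
    (hf : ∀ x, HasDerivAt f (f' x) x)
    (hf' : ∀ x, HasDerivAt f' (((v x : ℂ) - κ ^ 2) * f x) x)
    (hj : IsJostAtPlusInfinity κ f f') (M : ℝ) (hM0 : 0 ≤ M)
    (hM : ∀ x : ℝ, 0 ≤ x → ‖Complex.exp (-Complex.I * κ * x) * f x‖ ≤
      M * Real.exp (C / (2 * η) / (1 + x) ^ 2)) (x : ℝ) (hx : 0 ≤ x) :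
    ‖Complex.exp (-Complex.I * κ * x) * f x - 1‖ ≤
      M / 2 * (Real.exp (C / (2 * η) / (1 + x) ^ 2) - 1) := by
  set A := C / (2 * η) with hA
  have hA0 : 0 ≤ A := by positivity
  have hCA : C = 2 * η * A := by rw [hA]; field_simp
  have hexp0 : Tendsto (fun x : ℝ => Real.exp (-(κ.im * x))) atTop (nhds 0) :=
    Real.tendsto_exp_neg_atTop_nhds_zero.comp
      (tendsto_id.const_mul_atTop (hη.trans_le hκ))
  have hee : ∀ x : ℝ, Complex.exp (Complex.I * κ * x) * Complex.exp (-Complex.I * κ * x) = 1 := by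
    intro x; rw [← Complex.exp_add]; simp
  -- the derivative of m
  have hm' : Tendsto (fun x : ℝ => Complex.exp (-Complex.I * κ * x) * (f' x - Complex.I * κ * f x))
      atTop (nhds 0) := by
    have := hj.2.sub (hj.1.const_mul (Complex.I * κ))
    simp only [mul_one, sub_self] at this
    refine this.congr fun x => by ring
  have hP : ∀ x : ℝ, 0 ≤ x → ‖Complex.exp (Complex.I * κ * x) * (f' x - Complex.I * κ * f x)‖ ≤
      M * A * (Real.exp (-(2 * κ.im * x)) * (((1 + x) ^ 3)⁻¹ * Real.exp (A / (1 + x) ^ 2))) := by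
    refine fad_tail (g' := fun x => Complex.exp (Complex.I * κ * x) * (v x * f x))
      (h' := fun x => M * A * ((-(2 * κ.im) * Real.exp (-(2 * κ.im * x))) *
          (((1 + x) ^ 3)⁻¹ * Real.exp (A / (1 + x) ^ 2)) +
        Real.exp (-(2 * κ.im * x)) * (-(3 / (1 + x) ^ 4) * Real.exp (A / (1 + x) ^ 2) +
         ((1 + x) ^ 3)⁻¹ * (-(2 * A / (1 + x) ^ 3 * Real.exp (A / (1 + x) ^ 2))))))
      ?_ ?_ ?_ ?_ ?_
    · intro x hx
      have := (fad_exp_deriv (Complex.I * κ) x).mul ((hf' x).sub ((hf x).const_mul (Complex.I * κ)))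
      refine this.congr_deriv ?_
      simp only [Pi.sub_apply]
      linear_combination (-(Complex.exp (Complex.I * κ * x) * κ ^ 2 * f x)) * Complex.I_sq
    · intro x hx
      have h1 : HasDerivAt (fun x : ℝ => 1 + x) 1 x := (hasDerivAt_id x).const_add 1
      have hne : (1 + x) ≠ 0 := by positivity
      have h2 : HasDerivAt (fun x : ℝ => ((1 + x) ^ 3)⁻¹) (-(3 / (1 + x) ^ 4)) x := by
        have := (h1.fun_pow 3).fun_inv (pow_ne_zero 3 hne)
        refine this.congr_deriv ?_
        simp
        field_simp
      have h3 : HasDerivAt (fun x : ℝ => Real.exp (-(2 * κ.im * x)))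
          (-(2 * κ.im) * Real.exp (-(2 * κ.im * x))) x := by
        have := (((hasDerivAt_id x).const_mul (2 * κ.im)).neg).exp
        refine this.congr_deriv ?_
        simp
        ring
      exact (h3.mul (h2.mul (fad_phi_deriv A x hx))).const_mul (M * A)
    · intro x hx
      have e1 : ‖Complex.exp (Complex.I * κ * x) * (v x * f x)‖ =
          Real.exp (-(2 * κ.im * x)) * (|v x| * ‖Complex.exp (-Complex.I * κ * x) * f x‖) := by
        rw [norm_mul, norm_mul, norm_mul, fad_norm_exp, fad_norm_exp', Complex.norm_real,
          Real.norm_eq_abs]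
        have : Real.exp (-(κ.im * x)) = Real.exp (-(2 * κ.im * x)) * Real.exp (κ.im * x) := by
          rw [← Real.exp_add]; congr 1; ring
        rw [this]; ring
      rw [e1]
      have e2 : |v x| * ‖Complex.exp (-Complex.I * κ * x) * f x‖ ≤
          C / (1 + x) ^ 3 * (M * Real.exp (A / (1 + x) ^ 2)) :=
        mul_le_mul (hb x hx) (hM x hx) (norm_nonneg _) (by positivity)
      have e3 : C / (1 + x) ^ 3 * (M * Real.exp (A / (1 + x) ^ 2)) ≤
          M * A * (2 * κ.im * (((1 + x) ^ 3)⁻¹ * Real.exp (A / (1 + x) ^ 2))) := by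
        rw [hCA]
        have : 0 ≤ M * A * (((1 + x) ^ 3)⁻¹ * Real.exp (A / (1 + x) ^ 2)) := by positivity
        have h4 := mul_le_mul_of_nonneg_left hκ this
        rw [div_eq_mul_inv]
        nlinarith
      have e4 : 0 ≤ M * A * Real.exp (-(2 * κ.im * x)) *
          ((3 / (1 + x) ^ 4) * Real.exp (A / (1 + x) ^ 2) +
         ((1 + x) ^ 3)⁻¹ * ((2 * A / (1 + x) ^ 3 * Real.exp (A / (1 + x) ^ 2)))) := by positivity
      have e5 := mul_le_mul_of_nonneg_left (e2.trans e3) (Real.exp_pos (-(2 * κ.im * x))).le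
      linarith
    · have : Tendsto (fun x : ℝ => Complex.exp (2 * (Complex.I * κ * x))) atTop (nhds 0) := by
        rw [tendsto_zero_iff_norm_tendsto_zero]
        have := hexp0.mul hexp0
        simp only [mul_zero] at this
        refine this.congr fun x => ?_
        rw [two_mul, Complex.exp_add, norm_mul, fad_norm_exp]
      have := this.mul hm'
      simp only [mul_zero] at this
      refine this.congr fun x => ?_
      rw [two_mul, Complex.exp_add]
      linear_combination (Complex.exp (Complex.I * κ * x) * (f' x - Complex.I * κ * f x)) * hee x
    · have i1 : Tendsto (fun x : ℝ => ((1 + x) ^ 3)⁻¹) atTop (nhds 0) :=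
        tendsto_inv_atTop_zero.comp
          ((tendsto_pow_atTop (by norm_num)).comp (tendsto_atTop_add_const_left _ _ tendsto_id))
      have := ((hexp0.mul hexp0).mul (i1.mul (fad_phi_tendsto A))).const_mul (M * A)
      simp only [mul_zero, zero_mul] at this
      refine this.congr fun x => ?_
      rw [← Real.exp_add]
      congr 4; ring
  refine fad_tail (g := fun x : ℝ => Complex.exp (-Complex.I * κ * x) * f x - 1)
    (g' := fun x => Complex.exp (-Complex.I * κ * x) * (f' x - Complex.I * κ * f x))
    (h := fun x => M / 2 * (Real.exp (A / (1 + x) ^ 2) - 1))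
    (h' := fun x => M / 2 * -(2 * A / (1 + x) ^ 3 * Real.exp (A / (1 + x) ^ 2)))
    ?_ ?_ ?_ ?_ ?_ x hx
  · intro x hx
    have := ((fad_exp_deriv (-Complex.I * κ) x).mul (hf x)).sub_const 1
    refine this.congr_deriv ?_
    ring
  · intro x hx
    exact ((fad_phi_deriv A x hx).sub_const 1).const_mul _
  · intro x hx
    have e1 : ‖Complex.exp (-Complex.I * κ * x) * (f' x - Complex.I * κ * f x)‖ =
        Real.exp (2 * κ.im * x) * ‖Complex.exp (Complex.I * κ * x) * (f' x - Complex.I * κ * f x)‖ := by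
      rw [norm_mul, norm_mul, fad_norm_exp, fad_norm_exp', ← mul_assoc, ← Real.exp_add]
      congr 2; ring
    rw [e1]
    have e2 := mul_le_mul_of_nonneg_left (hP x hx) (Real.exp_pos (2 * κ.im * x)).le
    have e3 : Real.exp (2 * κ.im * x) * Real.exp (-(2 * κ.im * x)) = 1 := by
      rw [← Real.exp_add]; simp
    refine e2.trans (le_of_eq ?_)
    rw [div_eq_mul_inv (2 * A)]
    linear_combination (M * A * (((1 + x) ^ 3)⁻¹ * Real.exp (A / (1 + x) ^ 2))) * e3
  · simpa using hj.1.sub_const 1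
  · simpa using ((fad_phi_tendsto A).sub_const 1).const_mul (M / 2)

lemma fad_bdd {m : ℝ → ℂ} {l : ℂ} (hm : Continuous m) (ht : Tendsto m atTop (nhds l)) :
    ∃ B, 0 ≤ B ∧ ∀ x, 0 ≤ x → ‖m x‖ ≤ B := by
  have h1 : ∀ᶠ x in atTop, ‖m x‖ < ‖l‖ + 1 := ht.norm.eventually (gt_mem_nhds (by linarith))
  obtain ⟨X, hX⟩ := eventually_atTop.1 h1
  obtain ⟨B, hB⟩ := (isCompact_Icc (a := (0 : ℝ)) (b := X)).exists_bound_of_continuousOn hm.continuousOn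
  refine ⟨max B (‖l‖ + 1), le_max_of_le_right (by positivity), fun x hx => ?_⟩
  rcases le_total x X with h | h
  · exact (hB x ⟨hx, h⟩).trans (le_max_left _ _)
  · exact (hX x h).le.trans (le_max_right _ _)

lemma fad_jost (v : ℝ → ℝ) (C η : ℝ) (hη : 0 < η) (hC : 0 ≤ C)
    (hb : ∀ x, 0 ≤ x → |v x| ≤ C / (1 + x) ^ 3) (κ : ℂ) (hκ : η ≤ κ.im) (f f' : ℝ → ℂ)
    (hf : ∀ x, HasDerivAt f (f' x) x)
    (hf' : ∀ x, HasDerivAt f' (((v x : ℂ) - κ ^ 2) * f x) x)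
    (hj : IsJostAtPlusInfinity κ f f') (x : ℝ) (hx : 0 ≤ x) :
    ‖Complex.exp (-Complex.I * κ * x) * f x - 1‖ ≤
      Real.exp (C / (2 * η) / (1 + x) ^ 2) - 1 := by
  have hstep := fad_step v C η hη hC hb κ hκ f f' hf hf' hj
  set A := C / (2 * η) with hA
  have hA0 : 0 ≤ A := by positivity
  have hphi : ∀ x : ℝ, 0 ≤ x → 1 ≤ Real.exp (A / (1 + x) ^ 2) := fun x hx =>
    Real.one_le_exp (by positivity)
  have hfc : Continuous f := continuous_iff_continuousAt.2 fun x => (hf x).continuousAt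
  obtain ⟨B, hB0, hB⟩ := fad_bdd (by fun_prop) hj.1
  -- iterate
  have hit : ∀ n : ℕ, ∀ x : ℝ, 0 ≤ x → ‖Complex.exp (-Complex.I * κ * x) * f x‖ ≤
      (2 + B / 2 ^ n) * Real.exp (A / (1 + x) ^ 2) := by
    intro n
    induction n with
    | zero =>
      intro x hx
      have := hB x hx
      have := hphi x hx
      simp only [pow_zero, div_one]
      nlinarith
    | succ n ih =>
      intro x hx
      have h1 := hstep (2 + B / 2 ^ n) (by positivity) ih x hx
      have h2 := norm_le_norm_sub_add (Complex.exp (-Complex.I * κ * x) * f x) 1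
      have h3 := hphi x hx
      have h4 : 0 ≤ B / 2 ^ n := by positivity
      rw [norm_one] at h2
      have : B / 2 ^ (n + 1) = B / 2 ^ n / 2 := by rw [pow_succ]; field_simp
      rw [this]
      nlinarith
  have hM : ∀ x : ℝ, 0 ≤ x → ‖Complex.exp (-Complex.I * κ * x) * f x‖ ≤
      2 * Real.exp (A / (1 + x) ^ 2) := by
    intro x hx
    have t : Tendsto (fun n : ℕ => (2 + B / 2 ^ n) * Real.exp (A / (1 + x) ^ 2)) atTop
        (nhds ((2 + 0) * Real.exp (A / (1 + x) ^ 2))) :=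
      (tendsto_const_nhds.add (tendsto_const_nhds.div_atTop
        (tendsto_pow_atTop_atTop_of_one_lt (by norm_num)))).mul_const _
    have := ge_of_tendsto' t (fun n => hit n x hx)
    simpa using this
  have := hstep 2 (by norm_num) hM x hx
  simpa using this

lemma fad_jost' (v : ℝ → ℝ) (C η : ℝ) (hη : 0 < η) (hC : 0 ≤ C)
    (hb : ∀ x, 0 ≤ x → |v x| ≤ C / (1 + x) ^ 3) :
    ∃ K : ℝ, 0 ≤ K ∧ ∀ (κ : ℂ), η ≤ κ.im → ∀ (f f' : ℝ → ℂ),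
    (∀ x, HasDerivAt f (f' x) x) →
    (∀ x, HasDerivAt f' (((v x : ℂ) - κ ^ 2) * f x) x) →
    IsJostAtPlusInfinity κ f f' → ∀ (x : ℝ), 0 ≤ x →
    ‖Complex.exp (-Complex.I * κ * x) * f x - 1‖ ≤ K / (1 + x) ^ 2 := by
  have hA0 : 0 ≤ C / (2 * η) := by positivity
  refine ⟨C / (2 * η) * Real.exp (C / (2 * η)), by positivity,
    fun κ hκ f f' hf hf' hj x hx => ?_⟩
  refine (fad_jost v C η hη hC hb κ hκ f f' hf hf' hj x hx).trans ?_
  set A := C / (2 * η)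
  set y := A / (1 + x) ^ 2 with hy
  have hy0 : 0 ≤ y := by positivity
  have hyA : y ≤ A := div_le_self hA0 (one_le_pow₀ (by linarith))
  have h1 : 1 - y ≤ Real.exp (-y) := by have := Real.add_one_le_exp (-y); linarith
  have h2 : Real.exp y * Real.exp (-y) = 1 := by rw [← Real.exp_add]; simp
  have h3 : Real.exp y ≤ Real.exp A := Real.exp_le_exp.2 hyA
  have h4 : A * Real.exp A / (1 + x) ^ 2 = y * Real.exp A := by rw [hy]; ring
  rw [h4]
  nlinarith [Real.exp_pos y, mul_le_mul_of_nonneg_left h1 (Real.exp_pos y).le,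
    mul_le_mul_of_nonneg_left h3 hy0]

lemma fad_inv_tendsto (K : ℝ) : Tendsto (fun x : ℝ => K / (1 + x) ^ 2) atTop (nhds 0) :=
    Tendsto.div_atTop tendsto_const_nhds
      ((tendsto_pow_atTop (by norm_num)).comp (tendsto_atTop_add_const_left _ _ tendsto_id))

lemma fad_second (v : ℝ → ℝ) (C : ℝ) (hC : 0 ≤ C)
    (hb : ∀ x, 0 ≤ x → |v x| ≤ C / (1 + x) ^ 3) (k : ℂ) (hk : 0 < k.im) (f f' g g' : ℝ → ℂ)
    (hf : ∀ x, HasDerivAt f (f' x) x)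
    (hf' : ∀ x, HasDerivAt f' (((v x : ℂ) - k ^ 2) * f x) x)
    (hj : IsJostAtPlusInfinity k f f')
    (hg : ∀ x, HasDerivAt g (g' x) x) (a : ℂ)
    (hW : ∀ x, f' x * g x - f x * g' x = 2 * Complex.I * k * a) :
    (∃ K : ℝ, 0 ≤ K ∧ ∀ x : ℝ, 0 ≤ x →
      ‖Complex.exp (Complex.I * k * x) * g x - a‖ ≤ K / (1 + x) ^ 2) ∧
    Tendsto (fun x : ℝ => Complex.exp (Complex.I * k * x) * g' x) atTop
      (nhds (-Complex.I * k * a)) := by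
  obtain ⟨K, hK0, hK⟩ := fad_jost' v C k.im hk hC hb
  have hm := hK k le_rfl f f' hf hf' hj
  set η := k.im with hη
  have hee : ∀ x : ℝ, Complex.exp (Complex.I * k * x) * Complex.exp (-Complex.I * k * x) = 1 := by
    intro x; rw [← Complex.exp_add]; simp
  have hX1 : ∀ᶠ x : ℝ in atTop, K / (1 + x) ^ 2 < 1 / 2 :=
    (fad_inv_tendsto K).eventually (gt_mem_nhds (by norm_num))
  obtain ⟨X, hX⟩ := eventually_atTop.1 (hX1.and
    ((eventually_ge_atTop (2 / η)).and (eventually_ge_atTop 0)))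
  have hX0 : 0 ≤ X := (hX X le_rfl).2.2
  have hml : ∀ x, X ≤ x → 1 / 2 ≤ ‖Complex.exp (-Complex.I * k * x) * f x‖ := by
    intro x hx
    have h1 := hm x (hX0.trans hx)
    have h2 := (hX x hx).1
    have h3 := norm_sub_norm_le (1 : ℂ) (1 - Complex.exp (-Complex.I * k * x) * f x)
    rw [norm_sub_rev 1, sub_sub_cancel, norm_one] at h3
    linarith
  have hmu : ∀ x, X ≤ x → ‖Complex.exp (-Complex.I * k * x) * f x‖ ≤ 3 / 2 := by
    intro x hx
    have h1 := hm x (hX0.trans hx)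
    have h2 := (hX x hx).1
    have h3 := norm_le_norm_sub_add (Complex.exp (-Complex.I * k * x) * f x) 1
    rw [norm_one] at h3
    linarith
  have hf0 : ∀ x, X ≤ x → f x ≠ 0 := by
    intro x hx h0
    have := hml x hx
    rw [h0] at this
    norm_num at this
  have hbound : ∃ K : ℝ, 0 ≤ K ∧ ∀ x : ℝ, 0 ≤ x →
      ‖Complex.exp (Complex.I * k * x) * g x - a‖ ≤ K / (1 + x) ^ 2 := by
    set R : ℝ → ℂ := fun x => g x / f x - a * Complex.exp (-(2 * Complex.I * k) * x) with hR
    have hRd : ∀ x, X ≤ x → HasDerivAt R ((g' x * f x - g x * f' x) / f x ^ 2 -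
        a * (-(2 * Complex.I * k) * Complex.exp (-(2 * Complex.I * k) * x))) x := by
      intro x hx
      exact ((hg x).fun_div (hf x) (hf0 x hx)).sub ((fad_exp_deriv _ x).const_mul a)
    have he2 : ∀ x : ℝ, Complex.exp (-(2 * Complex.I * k) * x) =
        Complex.exp (-Complex.I * k * x) ^ 2 := by
      intro x; rw [← Complex.exp_nat_mul]; congr 1; push_cast; ring
    have hne : ∀ x : ℝ, ‖Complex.exp (-(2 * Complex.I * k) * x)‖ = Real.exp (2 * η * x) := by
      intro x; rw [he2, norm_pow, fad_norm_exp', ← Real.exp_nat_mul]; congr 1; push_cast; ring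
    have hRn : ∀ x, X ≤ x → ‖(g' x * f x - g x * f' x) / f x ^ 2 -
        a * (-(2 * Complex.I * k) * Complex.exp (-(2 * Complex.I * k) * x))‖ ≤
        20 * ‖k * a‖ * K * (Real.exp (2 * η * x) / (1 + x) ^ 2) := by
      intro x hx
      have hfx := hf0 x hx
      have hE := Complex.exp_ne_zero (-Complex.I * k * x)
      have e1 : (g' x * f x - g x * f' x) / f x ^ 2 -
        a * (-(2 * Complex.I * k) * Complex.exp (-(2 * Complex.I * k) * x)) =
        2 * Complex.I * (k * a) * Complex.exp (-(2 * Complex.I * k) * x) *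
        ((Complex.exp (-Complex.I * k * x) * f x - 1) * (Complex.exp (-Complex.I * k * x) * f x + 1)
          / (Complex.exp (-Complex.I * k * x) * f x) ^ 2) := by
        have : g' x * f x - g x * f' x = - (2 * Complex.I * k * a) := by rw [← hW x]; ring
        rw [this, he2]
        field_simp
        ring
      have h2 : ‖(2 * Complex.I : ℂ)‖ = 2 := by simp
      rw [e1, norm_mul, norm_mul, norm_mul, hne, h2, norm_div, norm_mul (_ - 1) _, norm_pow]
      set m := Complex.exp (-Complex.I * k * x) * f x
      have i1 : ‖m + 1‖ ≤ 5 / 2 := by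
        have := norm_add_le m 1
        rw [norm_one] at this
        linarith [hmu x hx]
      have i2 : 1 / 4 ≤ ‖m‖ ^ 2 := by nlinarith [hml x hx]
      have i3 : ‖m - 1‖ * ‖m + 1‖ / ‖m‖ ^ 2 ≤ 10 * (K / (1 + x) ^ 2) := by
        rw [div_le_iff₀ (by linarith)]
        have j1 := hm x (hX0.trans hx)
        have j2 : ‖m - 1‖ * ‖m + 1‖ ≤ K / (1 + x) ^ 2 * (5 / 2) :=
          mul_le_mul j1 i1 (norm_nonneg _) ((norm_nonneg _).trans j1)
        nlinarith [(norm_nonneg _).trans j1]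
      have := mul_le_mul_of_nonneg_left i3
        (show 0 ≤ 2 * ‖k * a‖ * Real.exp (2 * η * x) by positivity)
      refine this.trans (le_of_eq ?_)
      ring
    set Q := 20 * ‖k * a‖ * K / η + ‖R X‖ * (1 + X) ^ 2 with hQ
    have hQ0 : 0 ≤ Q := by positivity
    have hRb : ∀ x, X ≤ x → ‖R x‖ ≤ Q * (Real.exp (2 * η * x) / (1 + x) ^ 2) := by
      intro x hx
      have := fad_incr (g := R) (h := fun x => Q * (Real.exp (2 * η * x) / (1 + x) ^ 2))
        (h' := fun x => Q * (Real.exp (2 * η * x) * (2 * η / (1 + x) ^ 2 - 2 / (1 + x) ^ 3)))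
        hx hRd ?_ ?_
      · have h1 : ‖R X‖ ≤ Q * (Real.exp (2 * η * X) / (1 + X) ^ 2) := by
          have : 1 ≤ Real.exp (2 * η * X) := Real.one_le_exp (by positivity)
          rw [mul_div_assoc', le_div_iff₀ (by positivity)]
          have h2 : ‖R X‖ * (1 + X) ^ 2 ≤ Q := by
            rw [hQ]; have : 0 ≤ 20 * ‖k * a‖ * K / η := by positivity
            linarith
          nlinarith
        have h2 := norm_le_norm_sub_add (R x) (R X)
        linarith
      · intro y hy
        have hy0 := hX0.trans hy
        have hne : (1 + y) ≠ 0 := by positivity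
        have h1 : HasDerivAt (fun x : ℝ => 1 + x) 1 y := (hasDerivAt_id y).const_add 1
        have h3 := ((hasDerivAt_id y).const_mul (2 * η)).exp
        have := (h3.fun_div (h1.fun_pow 2) (pow_ne_zero 2 hne)).const_mul Q
        refine this.congr_deriv ?_
        simp only [id_eq, mul_one, Nat.cast_ofNat, Nat.reduceSub, pow_one]
        congr 1
        field_simp
      · intro y hy
        refine (hRn y hy).trans ?_
        have hy0 := hX0.trans hy
        have hy2 : 2 / η ≤ y := (hX y hy).2.1
        rw [div_le_iff₀ hk] at hy2
        have h1 : 20 * ‖k * a‖ * K ≤ Q * η := by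
          have : 20 * ‖k * a‖ * K / η * η = 20 * ‖k * a‖ * K := by field_simp
          rw [hQ, add_mul, this]
          have : 0 ≤ ‖R X‖ * (1 + X) ^ 2 * η := by positivity
          linarith
        have h2 : η / (1 + y) ^ 2 ≤ 2 * η / (1 + y) ^ 2 - 2 / (1 + y) ^ 3 := by
          have : 2 * η / (1 + y) ^ 2 - 2 / (1 + y) ^ 3 - η / (1 + y) ^ 2 =
            (η * (1 + y) - 2) / (1 + y) ^ 3 := by field_simp; ring
          have h5 : 0 ≤ (η * (1 + y) - 2) / (1 + y) ^ 3 :=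
            div_nonneg (by linarith) (by positivity)
          linarith
        have h3 := mul_le_mul_of_nonneg_left h2
          (show 0 ≤ Q * Real.exp (2 * η * y) by positivity)
        have h4 := mul_le_mul_of_nonneg_right h1
          (show 0 ≤ Real.exp (2 * η * y) / (1 + y) ^ 2 by positivity)
        calc _ ≤ _ := h4
          _ = Q * Real.exp (2 * η * y) * (η / (1 + y) ^ 2) := by ring
          _ ≤ _ := h3
          _ = _ := by ring
    have hgc : Continuous g := continuous_iff_continuousAt.2 fun x => (hg x).continuousAt
    obtain ⟨B, hB⟩ := (isCompact_Icc (a := (0 : ℝ)) (b := X)).exists_bound_of_continuousOn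
      (f := fun x : ℝ => Complex.exp (Complex.I * k * x) * g x - a) (by fun_prop)
    refine ⟨|B| * (1 + X) ^ 2 + (3 / 2 * Q + ‖a‖ * K), by positivity, fun x hx => ?_⟩
    rcases le_total x X with h | h
    · have h1 := hB x ⟨hx, h⟩
      rw [le_div_iff₀ (by positivity)]
      have h2 : (1 + x) ^ 2 ≤ (1 + X) ^ 2 := by gcongr
      have h3 : 0 ≤ 3 / 2 * Q + ‖a‖ * K := by positivity
      have h4 := mul_le_mul (h1.trans (le_abs_self B)) h2 (by positivity) (abs_nonneg B)
      linarith
    · have hfx := hf0 x h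
      have e1 : Complex.exp (Complex.I * k * x) * g x - a =
          Complex.exp (-Complex.I * k * x) * f x * (Complex.exp (Complex.I * k * x) ^ 2 * R x) +
          a * (Complex.exp (-Complex.I * k * x) * f x - 1) := by
        have h2 : f x * R x = g x - a * f x * Complex.exp (-Complex.I * k * x) ^ 2 := by
          simp only [hR, he2]; field_simp
        have h1 := hee x
        set E := Complex.exp (Complex.I * k * x)
        set D := Complex.exp (-Complex.I * k * x)
        linear_combination (-(D * E ^ 2)) * h2 + (-(E * g x) + a * f x * D * (E * D + 1)) * h1
      rw [e1]
      have n1 : ‖Complex.exp (Complex.I * k * x) ^ 2 * R x‖ ≤ Q / (1 + x) ^ 2 := by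
        rw [norm_mul, norm_pow, fad_norm_exp, ← Real.exp_nat_mul]
        have := mul_le_mul_of_nonneg_left (hRb x h)
          (Real.exp_pos (((2 : ℕ) : ℝ) * -(k.im * x))).le
        refine this.trans (le_of_eq ?_)
        have h5 : Real.exp (((2 : ℕ) : ℝ) * -(k.im * x)) * Real.exp (2 * η * x) = 1 := by
          rw [← Real.exp_add]; rw [← Real.exp_zero]; congr 1; push_cast; ring
        linear_combination (Q / (1 + x) ^ 2) * h5
      refine (norm_add_le _ _).trans ?_
      rw [norm_mul, norm_mul a]
      have n2 := mul_le_mul (hmu x h) n1 (norm_nonneg _) (by norm_num)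
      have n3 := mul_le_mul_of_nonneg_left (hm x hx) (norm_nonneg a)
      have n4 : 0 ≤ |B| * (1 + X) ^ 2 / (1 + x) ^ 2 := by positivity
      refine (add_le_add n2 n3).trans ?_
      have : (|B| * (1 + X) ^ 2 + (3 / 2 * Q + ‖a‖ * K)) / (1 + x) ^ 2 =
        |B| * (1 + X) ^ 2 / (1 + x) ^ 2 + (3 / 2 * (Q / (1 + x) ^ 2) + ‖a‖ * (K / (1 + x) ^ 2)) := by
        ring
      linarith
  refine ⟨hbound, ?_⟩
  obtain ⟨K2, hK20, hK2⟩ := hbound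
  have hn : Tendsto (fun x : ℝ => Complex.exp (Complex.I * k * x) * g x) atTop (nhds a) := by
    rw [tendsto_iff_norm_sub_tendsto_zero]
    refine squeeze_zero' (Eventually.of_forall fun _ => norm_nonneg _) ?_ (fad_inv_tendsto K2)
    filter_upwards [eventually_ge_atTop 0] with x hx using hK2 x hx
  have := ((hj.2.mul hn).sub_const (2 * Complex.I * k * a)).div hj.1 one_ne_zero
  have e : (Complex.I * k * a - 2 * Complex.I * k * a) / 1 = -Complex.I * k * a := by ring
  rw [e] at this
  refine this.congr' ?_
  filter_upwards [eventually_ge_atTop X] with x hx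
  have hfx := hf0 x hx
  have hE := Complex.exp_ne_zero (-Complex.I * k * x)
  simp only [Pi.div_apply]
  rw [div_eq_iff (mul_ne_zero hE hfx)]
  linear_combination (f' x * g x - f x * g' x) * hee x + hW x

lemma fad_wronsk (v : ℝ → ℝ) (κ k : ℂ) (f f' g g' : ℝ → ℂ)
    (hf : ∀ x, HasDerivAt f (f' x) x)
    (hf' : ∀ x, HasDerivAt f' (((v x : ℂ) - κ ^ 2) * f x) x)
    (hg : ∀ x, HasDerivAt g (g' x) x)
    (hg' : ∀ x, HasDerivAt g' (((v x : ℂ) - k ^ 2) * g x) x) (x : ℝ) :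
    HasDerivAt (fun x => f' x * g x - f x * g' x) ((k ^ 2 - κ ^ 2) * (f x * g x)) x := by
  have := ((hf' x).mul (hg x)).sub ((hf x).mul (hg' x))
  refine this.congr_deriv ?_
  ring

lemma fad_wronsk_const (v : ℝ → ℝ) (k : ℂ) (f f' g g' : ℝ → ℂ)
    (hf : ∀ x, HasDerivAt f (f' x) x)
    (hf' : ∀ x, HasDerivAt f' (((v x : ℂ) - k ^ 2) * f x) x)
    (hg : ∀ x, HasDerivAt g (g' x) x)
    (hg' : ∀ x, HasDerivAt g' (((v x : ℂ) - k ^ 2) * g x) x) (x : ℝ) :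
    f' x * g x - f x * g' x = f' 0 * g 0 - f 0 * g' 0 := by
  have h := fad_wronsk v k k f f' g g' hf hf' hg hg'
  exact is_const_of_deriv_eq_zero (f := fun x => f' x * g x - f x * g' x)
    (fun x => (h x).differentiableAt) (fun x => by rw [(h x).deriv]; ring) x 0

lemma fad_half (v : ℝ → ℝ) (C : ℝ) (hC : 0 ≤ C)
    (hb : ∀ x, 0 ≤ x → |v x| ≤ C / (1 + x) ^ 3) (k : ℂ) (hk : 0 < k.im)
    (F F' : ℝ → ℝ → ℂ) (g g' : ℝ → ℂ)
    (hF : ∀ s, 0 ≤ s → ∀ x, HasDerivAt (F s) (F' s x) x)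
    (hF' : ∀ s : ℝ, 0 ≤ s → ∀ x, HasDerivAt (F' s)
      (((v x : ℂ) - (k + Complex.I * s) ^ 2) * F s x) x)
    (hj : ∀ s : ℝ, 0 ≤ s → IsJostAtPlusInfinity (k + Complex.I * s) (F s) (F' s))
    (hg : ∀ x, HasDerivAt g (g' x) x)
    (hg' : ∀ x, HasDerivAt g' (((v x : ℂ) - k ^ 2) * g x) x)
    (a : ℂ) (ha : a ≠ 0)
    (hW0 : F' 0 0 * g 0 - F 0 0 * g' 0 = 2 * Complex.I * k * a) :
    ∃ L : ℂ, Tendsto (fun n : ℝ => ∫ x in (0)..n, (F 0 x * g x - a)) atTop (nhds L) ∧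
      Tendsto (fun s : ℝ => (F' s 0 * g 0 - F s 0 * g' 0 - 2 * Complex.I * k * a) / s)
        (nhdsWithin 0 (Ioi 0)) (nhds (2 * Complex.I * k * L - a)) ∧
      ∃ B : ℝ, 0 ≤ B ∧ ∀ s : ℝ, 0 < s → s ≤ 1 → ‖F s 0 - F 0 0‖ ≤ B * s ∧
        ‖F' s 0 - F' 0 0‖ ≤ B * s := by
  have hk0 : k ≠ 0 := by rintro rfl; simp at hk
  have hw0 : 2 * Complex.I * k * a ≠ 0 := by simp [hk0, ha]
  have hF0' : ∀ x, HasDerivAt (F' 0) (((v x : ℂ) - k ^ 2) * F 0 x) x := by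
    simpa using hF' 0 le_rfl
  have hj0 : IsJostAtPlusInfinity k (F 0) (F' 0) := by simpa using hj 0 le_rfl
  have hF0 := hF 0 le_rfl
  have hW : ∀ x, F' 0 x * g x - F 0 x * g' x = 2 * Complex.I * k * a := fun x => by
    rw [fad_wronsk_const v k (F 0) (F' 0) g g' hF0 hF0' hg hg' x, hW0]
  obtain ⟨⟨K2, hK20, hn⟩, hn'⟩ := fad_second v C hC hb k hk (F 0) (F' 0) g g' hF0 hF0' hj0 hg a hW
  obtain ⟨K, hK0, hK⟩ := fad_jost' v C k.im hk hC hb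
  have hm : ∀ s : ℝ, 0 ≤ s → ∀ x : ℝ, 0 ≤ x →
      ‖Complex.exp (-Complex.I * (k + Complex.I * s) * x) * F s x - 1‖ ≤ K / (1 + x) ^ 2 :=
    fun s hs => hK (k + Complex.I * s) (by simp [hs]) (F s) (F' s) (hF s hs) (hF' s hs) (hj s hs)
  have hsq : ∀ x : ℝ, 0 ≤ x → ∀ c : ℝ, 0 ≤ c → c / (1 + x) ^ 2 ≤ c := fun x hx c hc =>
    div_le_self hc (one_le_pow₀ (by linarith))
  -- key bound
  set G := K * (‖a‖ + K2) + K2 with hG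
  have hG0 : 0 ≤ G := by positivity
  have hexp : ∀ (s x : ℝ), Complex.exp (-(s : ℂ) * x) *
      (Complex.exp (-Complex.I * (k + Complex.I * s) * x) * Complex.exp (Complex.I * k * x)) = 1 := by
    intro s x
    rw [← Complex.exp_add, ← Complex.exp_add, ← Complex.exp_zero]
    congr 1
    linear_combination (-(s : ℂ) * x) * Complex.I_sq
  have hexpn : ∀ (s x : ℝ), ‖Complex.exp (-(s : ℂ) * x)‖ = Real.exp (-(s * x)) := by
    intro s x; rw [Complex.norm_exp]; simp
  have hkey : ∀ s : ℝ, 0 ≤ s → ∀ x : ℝ, 0 ≤ x →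
      ‖F s x * g x - a * Complex.exp (-(s : ℂ) * x)‖ ≤ G / (1 + x) ^ 2 := by
    intro s hs x hx
    have h1 := hm s hs x hx
    have h2 := hn x hx
    have e1 : F s x * g x - a * Complex.exp (-(s : ℂ) * x) = Complex.exp (-(s : ℂ) * x) *
        ((Complex.exp (-Complex.I * (k + Complex.I * s) * x) * F s x - 1) *
          (Complex.exp (Complex.I * k * x) * g x) + (Complex.exp (Complex.I * k * x) * g x - a)) := by
      linear_combination (-(F s x * g x)) * hexp s x
    rw [e1, norm_mul, hexpn]
    have h3 : Real.exp (-(s * x)) ≤ 1 := Real.exp_le_one_iff.2 (by nlinarith)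
    have h4 : ‖Complex.exp (Complex.I * k * x) * g x‖ ≤ ‖a‖ + K2 := by
      have := norm_le_norm_sub_add (Complex.exp (Complex.I * k * x) * g x) a
      have := hsq x hx K2 hK20
      linarith
    have h5 : ‖(Complex.exp (-Complex.I * (k + Complex.I * s) * x) * F s x - 1) *
          (Complex.exp (Complex.I * k * x) * g x) + (Complex.exp (Complex.I * k * x) * g x - a)‖ ≤
          G / (1 + x) ^ 2 := by
      refine (norm_add_le _ _).trans ?_
      rw [norm_mul]
      refine (add_le_add (mul_le_mul h1 h4 (norm_nonneg _) (by positivity)) h2).trans (le_of_eq ?_)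
      rw [hG]; ring
    calc _ ≤ 1 * (G / (1 + x) ^ 2) := mul_le_mul h3 h5 (norm_nonneg _) (by norm_num)
      _ = _ := one_mul _
  -- decay of the wronskian
  have hnt : Tendsto (fun x : ℝ => Complex.exp (Complex.I * k * x) * g x) atTop (nhds a) := by
    rw [tendsto_iff_norm_sub_tendsto_zero]
    refine squeeze_zero' (Eventually.of_forall fun _ => norm_nonneg _) ?_ (fad_inv_tendsto K2)
    filter_upwards [eventually_ge_atTop 0] with x hx using hn x hx
  have hes : ∀ s : ℝ, 0 < s → Tendsto (fun x : ℝ => Complex.exp (-(s : ℂ) * x)) atTop (nhds 0) := by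
    intro s hs
    rw [tendsto_zero_iff_norm_tendsto_zero]
    simp only [hexpn]
    exact Real.tendsto_exp_neg_atTop_nhds_zero.comp (tendsto_id.const_mul_atTop hs)
  have hWt : ∀ s : ℝ, 0 < s → Tendsto (fun x => (F' s x * g x - F s x * g' x) -
      ((k + Complex.I * s) ^ 2 - k ^ 2) * (a / s) * Complex.exp (-(s : ℂ) * x)) atTop (nhds 0) := by
    intro s hs
    have h1 := (hes s hs).mul (((hj s hs.le).2.mul hnt).sub ((hj s hs.le).1.mul hn'))
    have h2 := (hes s hs).const_mul (((k + Complex.I * s) ^ 2 - k ^ 2) * (a / s))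
    have := h1.sub h2
    simp only [zero_mul, mul_zero, sub_zero] at this
    refine this.congr fun x => ?_
    linear_combination (F' s x * g x - F s x * g' x) * hexp s x
  have hWd : ∀ s : ℝ, 0 < s → ∀ x : ℝ, HasDerivAt (fun x : ℝ => (F' s x * g x - F s x * g' x) -
      ((k + Complex.I * s) ^ 2 - k ^ 2) * (a / s) * Complex.exp (-(s : ℂ) * x))
      ((k ^ 2 - (k + Complex.I * s) ^ 2) * (F s x * g x - a * Complex.exp (-(s : ℂ) * x))) x := by
    intro s hs x
    have hs0 : (s : ℂ) ≠ 0 := by exact_mod_cast hs.ne'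
    have := (fad_wronsk v _ k (F s) (F' s) g g' (hF s hs.le) (hF' s hs.le) hg hg' x).sub
      ((fad_exp_deriv (-(s : ℂ)) x).const_mul (((k + Complex.I * s) ^ 2 - k ^ 2) * (a / s)))
    refine this.congr_deriv ?_
    field_simp
    ring
  have hkk : ∀ s : ℝ, (k + Complex.I * s) ^ 2 - k ^ 2 = s * (2 * Complex.I * k - s) := by
    intro s; linear_combination ((s : ℂ) ^ 2) * Complex.I_sq
  set c := 2 * ‖k‖ + 1 with hc
  have hc0 : 0 ≤ c := by positivity
  have hkn : ∀ s : ℝ, 0 < s → s ≤ 1 → ‖k ^ 2 - (k + Complex.I * s) ^ 2‖ ≤ c * s := by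
    intro s hs hs1
    rw [norm_sub_rev, hkk, norm_mul, Complex.norm_real, Real.norm_of_nonneg hs.le, mul_comm]
    refine mul_le_mul_of_nonneg_right ?_ hs.le
    refine (norm_sub_le _ _).trans ?_
    rw [Complex.norm_real, Real.norm_of_nonneg hs.le, hc]
    simp [hs1]
  -- bound of the wronskian with g
  have hq : ∀ s : ℝ, 0 < s → s ≤ 1 → ∀ x : ℝ, 0 ≤ x →
      ‖(F' s x * g x - F s x * g' x) - 2 * Complex.I * k * a‖ ≤
        (c * G + ‖2 * Complex.I * k * a‖ * x + ‖a‖) * s := by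
    intro s hs hs1 x hx
    have hs0 : (s : ℂ) ≠ 0 := by exact_mod_cast hs.ne'
    have h1 := fad_tail (h := fun x => c * s * (G / (1 + x)))
      (h' := fun x => c * s * (-(G / (1 + x) ^ 2))) (fun x _ => hWd s hs x) ?_ ?_ (hWt s hs) ?_ x hx
    · have h2 : c * s * (G / (1 + x)) ≤ c * s * G :=
        mul_le_mul_of_nonneg_left (div_le_self hG0 (by linarith)) (by positivity)
      have e1 : (F' s x * g x - F s x * g' x) - 2 * Complex.I * k * a =
        ((F' s x * g x - F s x * g' x) -
          ((k + Complex.I * s) ^ 2 - k ^ 2) * (a / s) * Complex.exp (-(s : ℂ) * x)) +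
        ((2 * Complex.I * k * a) * (Complex.exp (-(s : ℂ) * x) - 1)
          - s * (a * Complex.exp (-(s : ℂ) * x))) := by
        rw [hkk]; field_simp; ring
      rw [e1]
      have h3 : ‖Complex.exp (-(s : ℂ) * x) - 1‖ ≤ s * x := by
        have : Complex.exp (-(s : ℂ) * x) - 1 = ((Real.exp (-(s * x)) - 1 : ℝ) : ℂ) := by
          push_cast; ring_nf
        rw [this, Complex.norm_real, Real.norm_eq_abs, abs_le]
        have i1 := Real.add_one_le_exp (-(s * x))
        have i2 : Real.exp (-(s * x)) ≤ 1 := Real.exp_le_one_iff.2 (by nlinarith)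
        have i3 : 0 ≤ s * x := by positivity
        constructor <;> linarith
      have h4 : ‖Complex.exp (-(s : ℂ) * x)‖ ≤ 1 := by
        rw [hexpn]; exact Real.exp_le_one_iff.2 (by nlinarith)
      refine (norm_add_le _ _).trans ?_
      have h5 := norm_sub_le ((2 * Complex.I * k * a) * (Complex.exp (-(s : ℂ) * x) - 1))
        (s * (a * Complex.exp (-(s : ℂ) * x)))
      rw [norm_mul (2 * Complex.I * k * a), norm_mul (s : ℂ), norm_mul a, Complex.norm_real,
        Real.norm_of_nonneg hs.le] at h5
      have h6 := mul_le_mul_of_nonneg_left h3 (norm_nonneg (2 * Complex.I * k * a))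
      have h7 : s * (‖a‖ * ‖Complex.exp (-(s : ℂ) * x)‖) ≤ s * (‖a‖ * 1) := by gcongr
      linarith
    · intro y hy
      have hne : 1 + y ≠ 0 := by positivity
      have h1 : HasDerivAt (fun x : ℝ => 1 + x) 1 y := (hasDerivAt_id y).const_add 1
      have := ((hasDerivAt_const y G).fun_div h1 hne).const_mul (c * s)
      refine this.congr_deriv ?_
      ring
    · intro y hy
      rw [norm_mul]
      have := mul_le_mul (hkn s hs hs1) (hkey s hs.le y hy) (norm_nonneg _) (by positivity)
      linarith
    · have : Tendsto (fun x : ℝ => G / (1 + x)) atTop (nhds 0) :=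
        Tendsto.div_atTop tendsto_const_nhds (tendsto_atTop_add_const_left _ _ tendsto_id)
      simpa using this.const_mul (c * s)
  -- bound of the wronskian with F 0
  have hFn : ∀ s : ℝ, 0 ≤ s → ∀ x : ℝ, 0 ≤ x → ‖F s x‖ ≤ (1 + K) * Real.exp (-(k.im * x)) := by
    intro s hs x hx
    have h1 := hm s hs x hx
    have h2 := norm_le_norm_sub_add (Complex.exp (-Complex.I * (k + Complex.I * s) * x) * F s x) 1
    rw [norm_one] at h2
    have h3 := hsq x hx K hK0
    have h4 : ‖Complex.exp (-Complex.I * (k + Complex.I * s) * x) * F s x‖ ≤ 1 + K := by linarith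
    rw [norm_mul, fad_norm_exp'] at h4
    have h5 : Real.exp (k.im * x) ≤ Real.exp ((k + Complex.I * s).im * x) := by
      apply Real.exp_le_exp.2
      have : (k + Complex.I * s).im = k.im + s := by simp
      rw [this]; nlinarith
    have h6 : Real.exp (k.im * x) * ‖F s x‖ ≤ 1 + K :=
      (mul_le_mul_of_nonneg_right h5 (norm_nonneg _)).trans h4
    have h7 := mul_le_mul_of_nonneg_right h6 (Real.exp_pos (-(k.im * x))).le
    have h8 : Real.exp (k.im * x) * Real.exp (-(k.im * x)) = 1 := by rw [← Real.exp_add]; simp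
    calc ‖F s x‖ = Real.exp (k.im * x) * ‖F s x‖ * Real.exp (-(k.im * x)) := by
          linear_combination (-‖F s x‖) * h8
      _ ≤ _ := h7
  set P := (1 + K) ^ 2 / (2 * k.im) with hP
  have hP0 : 0 ≤ P := by positivity
  have hp : ∀ s : ℝ, 0 < s → s ≤ 1 → ∀ x : ℝ, 0 ≤ x →
      ‖F' s x * F 0 x - F s x * F' 0 x‖ ≤ c * P * s := by
    intro s hs hs1 x hx
    have e0 : Tendsto (fun x : ℝ => Real.exp (-(2 * k.im * x))) atTop (nhds 0) :=
      Real.tendsto_exp_neg_atTop_nhds_zero.comp (tendsto_id.const_mul_atTop (by positivity))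
    have h1 := fad_tail (h := fun x => c * s * (P * Real.exp (-(2 * k.im * x))))
      (h' := fun x => c * s * (P * (-(2 * k.im) * Real.exp (-(2 * k.im * x)))))
      (fun x _ => fad_wronsk v _ k (F s) (F' s) (F 0) (F' 0) (hF s hs.le) (hF' s hs.le) hF0 hF0' x)
      ?_ ?_ ?_ ?_ x hx
    · have h2 : Real.exp (-(2 * k.im * x)) ≤ 1 :=
        Real.exp_le_one_iff.2 (by have : 0 ≤ 2 * k.im * x := by positivity
                                  linarith)
      have h3 : c * s * (P * Real.exp (-(2 * k.im * x))) ≤ c * s * (P * 1) := by gcongr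
      linarith
    · intro y hy
      have := (((hasDerivAt_id y).const_mul (2 * k.im)).neg).exp
      have := (this.const_mul P).const_mul (c * s)
      refine this.congr_deriv ?_
      simp only [id_eq, Pi.neg_apply]
      ring
    · intro y hy
      rw [norm_mul, norm_mul]
      have h2 := mul_le_mul (hFn s hs.le y hy) (hFn 0 le_rfl y hy) (norm_nonneg _) (by positivity)
      have h3 := mul_le_mul (hkn s hs hs1) h2 (by positivity) (by positivity)
      refine h3.trans (le_of_eq ?_)
      have e2 : Real.exp (-(2 * k.im * y)) = Real.exp (-(k.im * y)) * Real.exp (-(k.im * y)) := by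
        rw [← Real.exp_add]; congr 1; ring
      rw [e2, hP]
      field_simp
    · have h1 : Tendsto (fun x : ℝ => Complex.exp (2 * Complex.I * (k + Complex.I * (s / 2)) * x))
          atTop (nhds 0) := by
        rw [tendsto_zero_iff_norm_tendsto_zero]
        have : Tendsto (fun x : ℝ => Real.exp (-((2 * k.im + s) * x))) atTop (nhds 0) :=
          Real.tendsto_exp_neg_atTop_nhds_zero.comp (tendsto_id.const_mul_atTop (by positivity))
        refine this.congr fun x => ?_
        rw [Complex.norm_exp]
        congr 1
        simp [Complex.mul_re, Complex.mul_im]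
        left
        ring
      have h2 := h1.mul (((hj s hs.le).2.mul hj0.1).sub ((hj s hs.le).1.mul hj0.2))
      rw [zero_mul] at h2
      refine h2.congr fun x => ?_
      have h3 : Complex.exp (2 * Complex.I * (k + Complex.I * (s / 2)) * x) *
        (Complex.exp (-Complex.I * (k + Complex.I * s) * x) * Complex.exp (-Complex.I * k * x)) = 1 := by
        rw [← Complex.exp_add, ← Complex.exp_add, ← Complex.exp_zero]
        congr 1
        ring
      linear_combination (F' s x * F 0 x - F s x * F' 0 x) * h3
    · simpa using (e0.const_mul P).const_mul (c * s)
  -- pointwise Lipschitz bound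
  have hLip : ∀ x : ℝ, 0 ≤ x → ∃ B : ℝ, 0 ≤ B ∧ ∀ s : ℝ, 0 < s → s ≤ 1 →
      ‖F s x - F 0 x‖ ≤ B * s ∧ ‖F' s x - F' 0 x‖ ≤ B * s := by
    intro x hx
    set Q := c * G + ‖2 * Complex.I * k * a‖ * x + ‖a‖
    have hQ0 : 0 ≤ Q := by positivity
    set w := 2 * Complex.I * k * a with hw
    have hwn : 0 < ‖w‖ := norm_pos_iff.2 hw0
    have gen : ∀ (p q y z : ℂ) (s : ℝ), 0 < s → ‖p‖ ≤ c * P * s → ‖q‖ ≤ Q * s →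
        ‖(q * y - p * z) / w‖ ≤ (Q * ‖y‖ + c * P * ‖z‖) / ‖w‖ * s := by
      intro p q y z s hs h1 h2
      rw [norm_div, div_mul_eq_mul_div]
      refine div_le_div_of_nonneg_right ?_ hwn.le
      refine (norm_sub_le _ _).trans ?_
      rw [norm_mul, norm_mul]
      have := mul_le_mul_of_nonneg_right h1 (norm_nonneg z)
      have := mul_le_mul_of_nonneg_right h2 (norm_nonneg y)
      linarith
    refine ⟨(Q * ‖F 0 x‖ + c * P * ‖g x‖) / ‖w‖ + (Q * ‖F' 0 x‖ + c * P * ‖g' x‖) / ‖w‖,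
      by positivity, fun s hs hs1 => ?_⟩
    have h1 := hp s hs hs1 x hx
    have h2 := hq s hs hs1 x hx
    have g1 := gen _ _ (F 0 x) (g x) s hs h1 h2
    have g2 := gen _ _ (F' 0 x) (g' x) s hs h1 h2
    have p1 : 0 ≤ (Q * ‖F 0 x‖ + c * P * ‖g x‖) / ‖w‖ * s := by positivity
    have p2 : 0 ≤ (Q * ‖F' 0 x‖ + c * P * ‖g' x‖) / ‖w‖ * s := by positivity
    have e1 : F s x - F 0 x = ((F' s x * g x - F s x * g' x - w) * F 0 x -
      (F' s x * F 0 x - F s x * F' 0 x) * g x) / w := by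
      rw [eq_div_iff hw0]
      linear_combination (-F s x) * hW x
    have e2 : F' s x - F' 0 x = ((F' s x * g x - F s x * g' x - w) * F' 0 x -
      (F' s x * F 0 x - F s x * F' 0 x) * g' x) / w := by
      rw [eq_div_iff hw0]
      linear_combination (-F' s x) * hW x
    rw [e1, e2, add_mul]
    constructor <;> linarith
  have hFc : ∀ s, 0 ≤ s → Continuous (F s) := fun s hs =>
    continuous_iff_continuousAt.2 fun x => (hF s hs x).continuousAt
  have hgc : Continuous g := continuous_iff_continuousAt.2 fun x => (hg x).continuousAt
  have hint : IntegrableOn (fun x : ℝ => G * (1 + x ^ 2)⁻¹) (Ioi 0) :=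
    (integrable_inv_one_add_sq.const_mul G).integrableOn
  have hkey' : ∀ s : ℝ, 0 ≤ s → ∀ x : ℝ, 0 < x →
      ‖F s x * g x - a * Complex.exp (-(s : ℂ) * x)‖ ≤ G * (1 + x ^ 2)⁻¹ := by
    intro s hs x hx
    refine (hkey s hs x hx.le).trans ?_
    rw [div_eq_mul_inv]
    refine mul_le_mul_of_nonneg_left ?_ hG0
    exact inv_anti₀ (by positivity) (by nlinarith)
  have hmeas : ∀ s : ℝ, 0 ≤ s → AEStronglyMeasurable
      (fun x : ℝ => F s x * g x - a * Complex.exp (-(s : ℂ) * x)) (volume.restrict (Ioi 0)) := by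
    intro s hs
    have := hFc s hs
    exact Continuous.aestronglyMeasurable (by fun_prop)
  have hIs : ∀ s : ℝ, 0 ≤ s → IntegrableOn
      (fun x : ℝ => F s x * g x - a * Complex.exp (-(s : ℂ) * x)) (Ioi 0) := by
    intro s hs
    refine Integrable.mono' hint (hmeas s hs) ?_
    exact (ae_restrict_iff' measurableSet_Ioi).2 (Eventually.of_forall fun x hx => hkey' s hs x hx)
  have hI0 : (fun x : ℝ => F 0 x * g x - a * Complex.exp (-((0 : ℝ) : ℂ) * x)) =
      fun x => F 0 x * g x - a := by
    funext x; simp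
  have hJ : ∀ s : ℝ, 0 < s → F' s 0 * g 0 - F s 0 * g' 0 - 2 * Complex.I * k * a =
      s * ((2 * Complex.I * k - s) *
        (∫ x in Ioi (0 : ℝ), (F s x * g x - a * Complex.exp (-(s : ℂ) * x))) - a) := by
    intro s hs
    have hs0 : (s : ℂ) ≠ 0 := by exact_mod_cast hs.ne'
    have h1 := integral_Ioi_of_hasDerivAt_of_tendsto' (a := (0 : ℝ))
      (fun x _ => hWd s hs x) ((hIs s hs.le).const_mul _) (hWt s hs)
    rw [integral_const_mul] at h1
    simp only [Complex.ofReal_zero, mul_zero, Complex.exp_zero, mul_one, zero_sub] at h1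
    have h2 : ((k + Complex.I * s) ^ 2 - k ^ 2) * (a / s) = (2 * Complex.I * k - s) * a := by
      rw [hkk]; field_simp
    rw [h2] at h1
    have h3 : k ^ 2 - (k + Complex.I * s) ^ 2 = - (s * (2 * Complex.I * k - s)) := by
      rw [← hkk]; ring
    rw [h3] at h1
    linear_combination h1
  refine ⟨∫ x in Ioi (0 : ℝ), (F 0 x * g x - a), ?_, ?_, hLip 0 le_rfl⟩
  · have := hIs 0 le_rfl
    rw [hI0] at this
    exact intervalIntegral_tendsto_integral_Ioi 0 this tendsto_id
  · have hdc : Tendsto (fun s : ℝ => ∫ x in Ioi (0 : ℝ),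
        (F s x * g x - a * Complex.exp (-(s : ℂ) * x))) (nhdsWithin 0 (Ioi 0))
        (nhds (∫ x in Ioi (0 : ℝ), (F 0 x * g x - a))) := by
      refine tendsto_integral_filter_of_dominated_convergence (fun x : ℝ => G * (1 + x ^ 2)⁻¹)
        ?_ ?_ hint ?_
      · filter_upwards [self_mem_nhdsWithin] with s hs using hmeas s (le_of_lt hs)
      · filter_upwards [self_mem_nhdsWithin] with s hs
        exact (ae_restrict_iff' measurableSet_Ioi).2
          (Eventually.of_forall fun x hx => hkey' s (le_of_lt hs) x hx)
      · refine (ae_restrict_iff' measurableSet_Ioi).2 (Eventually.of_forall fun x hx => ?_)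
        have t1 : Tendsto (fun s : ℝ => F s x) (nhdsWithin 0 (Ioi 0)) (nhds (F 0 x)) := by
          obtain ⟨B, hB0, hB⟩ := hLip x (le_of_lt hx)
          rw [tendsto_iff_norm_sub_tendsto_zero]
          have tB : Tendsto (fun s : ℝ => B * s) (nhdsWithin 0 (Ioi 0)) (nhds 0) := by
            have : Continuous fun s : ℝ => B * s := by fun_prop
            simpa using (this.tendsto 0).mono_left nhdsWithin_le_nhds
          refine squeeze_zero' (Eventually.of_forall fun _ => norm_nonneg _) ?_ tB
          filter_upwards [Ioc_mem_nhdsGT (show (0 : ℝ) < 1 by norm_num)] with s hs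
          exact (hB s hs.1 hs.2).1
        have t2 : Tendsto (fun s : ℝ => a * Complex.exp (-(s : ℂ) * x)) (nhdsWithin 0 (Ioi 0))
            (nhds a) := by
          have : Continuous fun s : ℝ => a * Complex.exp (-(s : ℂ) * x) := by fun_prop
          simpa using (this.tendsto 0).mono_left nhdsWithin_le_nhds
        exact (t1.mul_const _).sub t2
    have t3 : Tendsto (fun s : ℝ => 2 * Complex.I * k - (s : ℂ)) (nhdsWithin 0 (Ioi 0))
        (nhds (2 * Complex.I * k)) := by
      have : Continuous fun s : ℝ => 2 * Complex.I * k - (s : ℂ) := by fun_prop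
      simpa using (this.tendsto 0).mono_left nhdsWithin_le_nhds
    refine ((t3.mul hdc).sub_const a).congr' ?_
    filter_upwards [self_mem_nhdsWithin] with s hs
    have hs0 : (s : ℂ) ≠ 0 := by exact_mod_cast (ne_of_gt hs)
    rw [hJ s hs, mul_div_cancel_left₀ _ hs0]
/-- Faddeev's formula. For a bounded continuous potential with
`|v(x)| ≤ C₀(1+|x|)^{-3-ε}` and `Im k > 0` with `a(k) ≠ 0`, the limit
`lim_{n→∞} ∫_{-n}^n (f₁(x,k) f₂(x,k) - a(k)) dx` exists and equals `i·ȧ(k)`,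
where `a(k) = W(f₁(·,k), f₂(·,k))/(2ik)` and `ȧ` is the `k`-derivative of `a`.
(Equivalently, `Tr(R_λ - R⁰_λ) = -(d/dλ) log a(√λ)`, i.e. `det(H - λI) = a(√λ)`.) -/
theorem faddeev_determinant_formula
    (v : ℝ → ℝ) (hv : Continuous v)
    (ε C₀ : ℝ) (hε : 0 < ε) (hC₀ : 0 < C₀)
    (hbound : ∀ x : ℝ, |v x| ≤ C₀ * (1 + |x|) ^ (-(3 + ε)))
    (f₁ f₁' f₁'' f₂ f₂' f₂'' : ℂ → ℝ → ℂ)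
    (h1 : ∀ κ : ℂ, 0 ≤ κ.im → κ ≠ 0 → IsSchrodingerSolution v κ (f₁ κ) (f₁' κ) (f₁'' κ))
    (hj1 : ∀ κ : ℂ, 0 ≤ κ.im → κ ≠ 0 → IsJostAtPlusInfinity κ (f₁ κ) (f₁' κ))
    (h2 : ∀ κ : ℂ, 0 ≤ κ.im → κ ≠ 0 → IsSchrodingerSolution v κ (f₂ κ) (f₂' κ) (f₂'' κ))
    (hj2 : ∀ κ : ℂ, 0 ≤ κ.im → κ ≠ 0 → IsJostAtMinusInfinity κ (f₂ κ) (f₂' κ))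
    (a : ℂ → ℂ)
    (ha : ∀ κ : ℂ, 0 ≤ κ.im → κ ≠ 0 →
      a κ = (f₁' κ 0 * f₂ κ 0 - f₁ κ 0 * f₂' κ 0) / (2 * Complex.I * κ))
    (k : ℂ) (hk : 0 < k.im) (hak : a k ≠ 0)
    (a' : ℂ) (hda : HasDerivAt a a' k) :
    Tendsto (fun n : ℝ => ∫ x in (-n)..n, (f₁ k x * f₂ k x - a k))
      atTop (nhds (Complex.I * a')) := by
  have hk0 : k ≠ 0 := by rintro rfl; simp at hk
  have hb : ∀ x : ℝ, |v x| ≤ C₀ / (1 + |x|) ^ 3 := by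
    intro x
    refine (hbound x).trans ?_
    rw [div_eq_mul_inv]
    refine mul_le_mul_of_nonneg_left ?_ hC₀.le
    have h1 : (1 : ℝ) ≤ 1 + |x| := by linarith [abs_nonneg x]
    have := Real.rpow_le_rpow_of_exponent_le h1 (show -(3 + ε) ≤ -(3 : ℝ) by linarith)
    refine this.trans (le_of_eq ?_)
    rw [Real.rpow_neg (by linarith)]
    norm_cast
  have him : ∀ s : ℝ, 0 ≤ s → 0 ≤ (k + Complex.I * s).im := by
    intro s hs; simp; linarith
  have hne : ∀ s : ℝ, 0 ≤ s → k + Complex.I * s ≠ 0 := by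
    intro s hs h
    have : (k + Complex.I * s).im = 0 := by rw [h]; simp
    simp at this
    linarith
  have hw : f₁' k 0 * f₂ k 0 - f₁ k 0 * f₂' k 0 = 2 * Complex.I * k * a k := by
    rw [ha k hk.le hk0]; field_simp
  have sol : ∀ κ f f' f'', IsSchrodingerSolution v κ f f' f'' →
      ∀ x, HasDerivAt f' (((v x : ℂ) - κ ^ 2) * f x) x := by
    intro κ f f' f'' h x
    refine (h.2.1 x).congr_deriv ?_
    linear_combination -(h.2.2.2 x)
  have refl1 : ∀ (f f' : ℝ → ℂ), (∀ x, HasDerivAt f (f' x) x) →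
      ∀ x, HasDerivAt (fun x => f (-x)) (-f' (-x)) x := by
    intro f f' h x
    have := HasDerivAt.scomp x (h (-x)) (hasDerivAt_neg x)
    simpa [Function.comp_def] using this
  have refl2 : ∀ (κ : ℂ) (f f' : ℝ → ℂ), (∀ x, HasDerivAt f' (((v x : ℂ) - κ ^ 2) * f x) x) →
      ∀ x, HasDerivAt (fun x => -f' (-x)) (((v (-x) : ℂ) - κ ^ 2) * f (-x)) x := by
    intro κ f f' h x
    have := (refl1 f' _ h x).fun_neg
    simpa using this
  have hk1 := h1 k hk.le hk0
  have hk2 := h2 k hk.le hk0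
  obtain ⟨L1, hL1, hD1, B1, hB10, hB1⟩ := fad_half v C₀ hC₀.le
    (fun x hx => by simpa [abs_of_nonneg hx] using hb x) k hk
    (fun s => f₁ (k + Complex.I * s)) (fun s => f₁' (k + Complex.I * s)) (f₂ k) (f₂' k)
    (fun s hs => (h1 _ (him s hs) (hne s hs)).1)
    (fun s hs => sol _ _ _ _ (h1 _ (him s hs) (hne s hs)))
    (fun s hs => hj1 _ (him s hs) (hne s hs)) hk2.1 (sol _ _ _ _ hk2) (a k) hak
    (by simpa using hw)
  obtain ⟨L2, hL2, hD2, B2, hB20, hB2⟩ := fad_half (fun x => v (-x)) C₀ hC₀.le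
    (fun x hx => by simpa [abs_of_nonneg hx] using hb (-x)) k hk
    (fun s x => f₂ (k + Complex.I * s) (-x)) (fun s x => -f₂' (k + Complex.I * s) (-x))
    (fun x => f₁ k (-x)) (fun x => -f₁' k (-x))
    (fun s hs => refl1 _ _ (h2 _ (him s hs) (hne s hs)).1)
    (fun s hs => refl2 _ _ _ (sol _ _ _ _ (h2 _ (him s hs) (hne s hs))))
    (fun s hs => by
      obtain ⟨j1, j2⟩ := hj2 _ (him s hs) (hne s hs)
      constructor
      · refine (j1.comp tendsto_neg_atTop_atBot).congr fun x => ?_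
        simp only [Function.comp]
        push_cast
        congr 2; ring
      · have := (j2.comp tendsto_neg_atTop_atBot).neg
        rw [neg_mul, neg_neg] at this
        refine this.congr fun x => ?_
        simp only [Function.comp]
        push_cast
        rw [mul_neg]
        ring_nf)
    (refl1 _ _ hk1.1) (refl2 _ _ _ (sol _ _ _ _ hk1)) (a k) hak
    (by simp only [Complex.ofReal_zero, mul_zero, add_zero, neg_zero]
        linear_combination hw)
  simp only [Complex.ofReal_zero, mul_zero, add_zero, neg_zero] at hL1 hL2 hD1 hD2 hB1 hB2
  -- derivative of the Wronskian
  have hder : HasDerivAt (fun s : ℝ => 2 * Complex.I * (k + Complex.I * s) * a (k + Complex.I * s))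
      (-2 * a k - 2 * k * a') 0 := by
    have i1 : HasDerivAt (fun s : ℝ => k + Complex.I * (s : ℂ)) Complex.I 0 := by
      simpa using ((Complex.ofRealCLM.hasDerivAt (x := (0 : ℝ))).const_mul Complex.I).const_add k
    have hda' : HasDerivAt a a' (k + Complex.I * ((0 : ℝ) : ℂ)) := by simpa using hda
    have i2 : HasDerivAt (fun s : ℝ => a (k + Complex.I * (s : ℂ))) (a' * Complex.I) 0 :=
      HasDerivAt.comp (𝕜 := ℝ) (𝕜' := ℂ) (0 : ℝ) hda' i1
    refine ((i1.const_mul (2 * Complex.I)).mul i2).congr_deriv ?_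
    simp only [Complex.ofReal_zero, mul_zero, add_zero]
    linear_combination (2 * a k + 2 * k * a') * Complex.I_sq
  have hslope := hder.tendsto_slope_zero_right
  have hpert : Tendsto (fun s : ℝ =>
      ((f₁' (k + Complex.I * s) 0 - f₁' k 0) * (f₂ (k + Complex.I * s) 0 - f₂ k 0) -
       (f₁ (k + Complex.I * s) 0 - f₁ k 0) * (f₂' (k + Complex.I * s) 0 - f₂' k 0)) / s)
      (nhdsWithin 0 (Ioi 0)) (nhds 0) := by
    have tB : Tendsto (fun s : ℝ => 2 * B1 * B2 * s) (nhdsWithin 0 (Ioi 0)) (nhds 0) := by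
      have : Continuous fun s : ℝ => 2 * B1 * B2 * s := by fun_prop
      simpa using (this.tendsto 0).mono_left nhdsWithin_le_nhds
    refine squeeze_zero_norm' ?_ tB
    filter_upwards [Ioc_mem_nhdsGT (show (0 : ℝ) < 1 by norm_num)] with s hs
    obtain ⟨b1, b1'⟩ := hB1 s hs.1 hs.2
    obtain ⟨b2, b2'⟩ := hB2 s hs.1 hs.2
    have b2'' : ‖f₂' (k + Complex.I * s) 0 - f₂' k 0‖ ≤ B2 * s := by
      rw [← norm_neg]; refine le_trans (le_of_eq ?_) b2'; congr 1; ring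
    have hs0 := hs.1
    rw [norm_div, Complex.norm_real, Real.norm_of_nonneg hs.1.le, div_le_iff₀ hs.1]
    refine (norm_sub_le _ _).trans ?_
    rw [norm_mul, norm_mul]
    have m1 := mul_le_mul b1' b2 (norm_nonneg _) (by positivity)
    have m2 := mul_le_mul b1 b2'' (norm_nonneg _) (by positivity)
    linarith
  have hsum := (hD1.add hD2).add hpert
  have huniq : -2 * a k - 2 * k * a' = (2 * Complex.I * k * L1 - a k) +
      (2 * Complex.I * k * L2 - a k) + 0 := by
    refine tendsto_nhds_unique hslope (hsum.congr' ?_)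
    filter_upwards [self_mem_nhdsWithin] with s hs
    have hs' : (0 : ℝ) < s := hs
    have hκ := hne s hs'.le
    have e1 : 2 * Complex.I * (k + Complex.I * s) * a (k + Complex.I * s) =
        f₁' (k + Complex.I * s) 0 * f₂ (k + Complex.I * s) 0 -
        f₁ (k + Complex.I * s) 0 * f₂' (k + Complex.I * s) 0 := by
      rw [ha _ (him s hs'.le) hκ]; field_simp
    simp only [zero_add, Complex.ofReal_zero, mul_zero, add_zero]
    rw [e1, ← hw, ← add_div, ← add_div, Complex.real_smul, Complex.ofReal_inv, div_eq_inv_mul]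
    congr 1
    ring
  have hL : Complex.I * a' = L2 + L1 := by
    have h2k : 2 * k ≠ 0 := by simp [hk0]
    apply mul_left_cancel₀ h2k
    linear_combination (-Complex.I) * huniq + (-(2 * k * (L1 + L2))) * Complex.I_sq
  rw [hL]
  refine (hL2.add hL1).congr fun n => ?_
  have c1 : Continuous (f₁ k) := continuous_iff_continuousAt.2 fun x => (hk1.1 x).continuousAt
  have c2 : Continuous (f₂ k) := continuous_iff_continuousAt.2 fun x => (hk2.1 x).continuousAt
  have cc : Continuous fun x => f₁ k x * f₂ k x - a k := by fun_prop
  rw [← intervalIntegral.integral_add_adjacent_intervals (a := -n) (b := 0) (c := n)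
    (cc.intervalIntegrable _ _) (cc.intervalIntegrable _ _)]
  congr 1
  have := intervalIntegral.integral_comp_neg (a := 0) (b := n) (fun x => f₁ k x * f₂ k x - a k)
  rw [neg_zero] at this
  rw [← this]
  refine intervalIntegral.integral_congr fun x _ => ?_
  simp only [mul_comm]
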